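/- For every odd integer n > 1, sum_{k=0}^{n-1} [4k-1] (q^{-2};q^4)_k^2 / (q^4;q^4)_k^2 · q^{4k} ≡ -(1-q+q^2) [n]_{q^2}^2 (mod [n]_{q^2}^2 Φ_n(q^2)). -/

import Mathlib

open RatFunc

noncomputable def q : RatFunc ℚ := RatFunc.X

/-- q-shifted factorial `(a;b)_m = ∏_{j=0}^{m-1} (1 - a b^j)`. -/
noncomputable def qpoch (a b : RatFunc ℚ) (m : ℕ) : RatFunc ℚ :=
  ∏ j ∈ Finset.range m, (1 - a * b ^ j)

/-- q-integer `[m] = (1-q^m)/(1-q)` for an arbitrary integer `m`. -/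
noncomputable def qintZ (m : ℤ) : RatFunc ℚ := (1 - q ^ m) / (1 - q)

/-- q-integer `[m] = 1 + q + ⋯ + q^{m-1}`. -/
noncomputable def qint (m : ℕ) : RatFunc ℚ := ∑ i ∈ Finset.range m, q ^ i

/-- q-binomial coefficient `(q;q)_n / ((q;q)_k (q;q)_{n-k})`. -/
noncomputable def qbinom (n k : ℕ) : RatFunc ℚ :=
  qpoch q q n / (qpoch q q k * qpoch q q (n - k))

/-- the polynomial `[n]_{q²} = 1 + q² + ⋯ + q^{2(n-1)}` in `ℚ[q]` -/
noncomputable def qintP2 (n : ℕ) : Polynomial ℚ := ∑ i ∈ Finset.range n, Polynomial.X ^ (2 * i)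

/-- the rational function `[n]_{q²} = 1 + q² + ⋯ + q^{2(n-1)}` -/
noncomputable def qint2 (n : ℕ) : RatFunc ℚ := ∑ i ∈ Finset.range n, q ^ (2 * i)

/-- the polynomial `Φ_n(q²)` in `ℚ[q]` -/
noncomputable def cyclo2 (n : ℕ) : Polynomial ℚ :=
  (Polynomial.cyclotomic n ℚ).comp (Polynomial.X ^ 2)

open Polynomial

/-- `(x;x)_m` as a product in an arbitrary commutative ring. -/
def qfac {R : Type*} [CommRing R] (x : R) (m : ℕ) : R :=
  ∏ j ∈ Finset.range m, (1 - x ^ (j + 1))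

/-- `(-x;x)_m` as a product in an arbitrary commutative ring. -/
def qfacNeg {R : Type*} [CommRing R] (x : R) (m : ℕ) : R :=
  ∏ j ∈ Finset.range m, (1 + x ^ (j + 1))

/-- `(x;x²)_m` as a product in an arbitrary commutative ring. -/
def qfacOdd {R : Type*} [CommRing R] (x : R) (m : ℕ) : R :=
  ∏ j ∈ Finset.range m, (1 - x ^ (2 * j + 1))

section CommRing

variable {R S : Type*} [CommRing R] [CommRing S]

lemma map_qfac (f : R →+* S) (x : R) (m : ℕ) : f (qfac x m) = qfac (f x) m := by
  simp [qfac]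

lemma map_qfacNeg (f : R →+* S) (x : R) (m : ℕ) : f (qfacNeg x m) = qfacNeg (f x) m := by
  simp [qfacNeg]

lemma qfac_succ (x : R) (m : ℕ) : qfac x (m + 1) = qfac x m * (1 - x ^ (m + 1)) :=
  Finset.prod_range_succ _ _

lemma qfac_two_mul (x : R) (m : ℕ) : qfac x (2 * m) = qfacOdd x m * (qfac x m * qfacNeg x m) := by
  induction m with
  | zero => simp [qfac, qfacOdd, qfacNeg]
  | succ m ih =>
    rw [show 2 * (m + 1) = 2 * m + 1 + 1 by ring, qfac_succ, qfac_succ, ih, qfac_succ]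
    simp only [qfacOdd, qfacNeg, Finset.prod_range_succ]
    ring

lemma qfac_sq (x : R) (m : ℕ) : qfac (x ^ 2) m = qfac x m * qfacNeg x m := by
  simp only [qfac, qfacNeg, ← Finset.prod_mul_distrib]
  refine Finset.prod_congr rfl fun j _ => ?_
  ring

lemma qfac_mul_qfac_dvd (x : R) (a b : ℕ) : qfac x a * qfac x b ∣ qfac x (a + b) := by
  induction h : a + b generalizing a b with
  | zero =>
    obtain ⟨rfl, rfl⟩ : a = 0 ∧ b = 0 := by omega
    simp [qfac]
  | succ s ih =>
    rcases a with _ | a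
    · obtain rfl : b = s + 1 := by omega
      simp [qfac]
    rcases b with _ | b
    · obtain rfl : a = s := by omega
      simp [qfac]
    obtain rfl : s = a + b + 1 := by omega
    obtain ⟨c, hc⟩ := ih a (b + 1) (by ring)
    obtain ⟨d, hd⟩ := ih (a + 1) b (by ring)
    refine ⟨c + x ^ (a + 1) * d, ?_⟩
    calc qfac x (a + b + 1 + 1)
        = qfac x (a + b + 1) * (1 - x ^ (a + 1))
          + x ^ (a + 1) * (qfac x (a + b + 1) * (1 - x ^ (b + 1))) := by
          rw [qfac_succ x (a + b + 1)]; ring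
      _ = qfac x a * qfac x (b + 1) * c * (1 - x ^ (a + 1))
          + x ^ (a + 1) * (qfac x (a + 1) * qfac x b * d * (1 - x ^ (b + 1))) := by
          rw [← hc, ← hd]
      _ = _ := by rw [qfac_succ x a, qfac_succ x b]; ring

end CommRing

section Polynomial

lemma one_sub_X_pow_ne_zero (m : ℕ) : (1 - Polynomial.X ^ (m + 1) : ℚ[X]) ≠ 0 := by
  intro h
  have := congrArg (Polynomial.eval 2) h
  simp only [Polynomial.eval_sub, Polynomial.eval_one, Polynomial.eval_pow, Polynomial.eval_X,
    Polynomial.eval_zero] at this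
  have h2 : (1 : ℚ) < 2 ^ (m + 1) := one_lt_pow₀ (by norm_num) (by omega)
  linarith

lemma qfac_X_ne_zero (m : ℕ) : qfac (Polynomial.X : ℚ[X]) m ≠ 0 :=
  Finset.prod_ne_zero_iff.2 fun j _ => one_sub_X_pow_ne_zero j

/-- The `q`-Catalan number is a polynomial. -/
lemma exists_qCatalan (m : ℕ) : ∃ c : ℚ[X],
    (1 - Polynomial.X ^ (m + 1)) * c * qfac Polynomial.X m ^ 2
      = (1 - Polynomial.X) * qfac Polynomial.X (2 * m) := by
  rcases m with _ | m
  · exact ⟨1, by simp [qfac]⟩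
  obtain ⟨g, hg⟩ := qfac_mul_qfac_dvd (Polynomial.X : ℚ[X]) (m + 1) (m + 1)
  obtain ⟨g', hg'⟩ := qfac_mul_qfac_dvd (Polynomial.X : ℚ[X]) (m + 1 + 1) m
  rw [show m + 1 + (m + 1) = 2 * (m + 1) by ring] at hg
  rw [show m + 1 + 1 + m = 2 * (m + 1) by ring] at hg'
  refine ⟨g - Polynomial.X * g', ?_⟩
  have e : (1 - Polynomial.X ^ (m + 1)) * (qfac Polynomial.X (m + 1 + 1) * qfac Polynomial.X m * g')
      = (1 - Polynomial.X ^ (m + 1 + 1)) * qfac Polynomial.X (m + 1) ^ 2 * g' := by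
    rw [qfac_succ Polynomial.X (m + 1), qfac_succ Polynomial.X m]; ring
  have e' : (1 - Polynomial.X ^ (m + 1)) * qfac (Polynomial.X : ℚ[X]) (2 * (m + 1))
      = (1 - Polynomial.X ^ (m + 1 + 1)) * qfac Polynomial.X (m + 1) ^ 2 * g' := by rw [← e, ← hg']
  calc (1 - Polynomial.X ^ (m + 1 + 1)) * (g - Polynomial.X * g') * qfac Polynomial.X (m + 1) ^ 2
      = (1 - Polynomial.X ^ (m + 1 + 1)) *
          (qfac Polynomial.X (m + 1) * qfac Polynomial.X (m + 1) * g)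
        - Polynomial.X * ((1 - Polynomial.X ^ (m + 1 + 1)) * qfac Polynomial.X (m + 1) ^ 2 * g') := by
        ring
    _ = (1 - Polynomial.X ^ (m + 1 + 1)) * qfac Polynomial.X (2 * (m + 1))
        - Polynomial.X * ((1 - Polynomial.X ^ (m + 1)) * qfac Polynomial.X (2 * (m + 1))) := by
        rw [← hg, ← e']
    _ = _ := by ring

lemma qfac_two_mul_succ {R : Type*} [CommRing R] (x : R) (m : ℕ) :
    qfac x (2 * (m + 1)) = qfac x (m + 1) * (1 - x ^ (m + 2)) *
      ∏ j ∈ Finset.range m, (1 - x ^ (m + 2 + (j + 1))) := by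
  rw [show 2 * (m + 1) = (m + 2) + m by ring, qfac, Finset.prod_range_add]
  change qfac x (m + 1 + 1) * _ = _
  rw [qfac_succ]
  rfl

/-- The `q`-Catalan number of index `n - 1` is `-ζ` at a primitive `n`-th root of unity `ζ`. -/
lemma aeval_qCatalan {m : ℕ} {ζ : ℂ} (hζ : IsPrimitiveRoot ζ (m + 2)) {c : ℚ[X]}
    (hc : (1 - Polynomial.X ^ (m + 2)) * c * qfac Polynomial.X (m + 1) ^ 2
      = (1 - Polynomial.X) * qfac Polynomial.X (2 * (m + 1))) :
    aeval ζ c = -ζ := by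
  have h1 : c * qfac Polynomial.X (m + 1)
      = (1 - Polynomial.X) * ∏ j ∈ Finset.range m, (1 - Polynomial.X ^ (m + 2 + (j + 1))) := by
    apply mul_left_cancel₀ (mul_ne_zero (one_sub_X_pow_ne_zero (m + 1)) (qfac_X_ne_zero (m + 1)))
    rw [qfac_two_mul_succ] at hc
    linear_combination hc
  have h2 := congrArg (aeval ζ) h1
  have hm : aeval ζ (qfac (Polynomial.X : ℚ[X]) (m + 1)) = qfac ζ (m + 1) := by
    simpa using map_qfac (aeval ζ : ℚ[X] →ₐ[ℚ] ℂ).toRingHom Polynomial.X (m + 1)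
  simp only [map_mul, map_sub, map_one, map_prod, map_pow, aeval_X, hm] at h2
  have h3 : ∏ j ∈ Finset.range m, (1 - ζ ^ (m + 2 + (j + 1))) = qfac ζ m := by
    refine Finset.prod_congr rfl fun j _ => ?_
    rw [pow_add, hζ.pow_eq_one, one_mul]
  have h4 : qfac ζ m ≠ 0 := Finset.prod_ne_zero_iff.2 fun j hj => by
    rw [sub_ne_zero]
    exact (hζ.pow_ne_one_of_pos_of_lt (by omega) (by have := Finset.mem_range.1 hj; omega)).symm
  rw [h3, qfac_succ] at h2
  have h5 : aeval ζ c * (1 - ζ ^ (m + 1)) = 1 - ζ :=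
    mul_right_cancel₀ h4 (by linear_combination h2)
  have h6 : ζ ^ (m + 1) * ζ = 1 := by rw [← pow_succ, hζ.pow_eq_one]
  have h7 : ζ - 1 ≠ 0 := sub_ne_zero.2 (hζ.ne_one (by omega))
  exact mul_right_cancel₀ h7 (by linear_combination ζ * h5 + aeval ζ c * h6)

lemma qfacNeg_of_isPrimitiveRoot {m : ℕ} (hm : Odd (m + 1)) {ζ : ℂ}
    (hζ : IsPrimitiveRoot ζ (m + 1)) : qfacNeg ζ m = 1 := by
  have h := X_pow_sub_C_eq_prod hζ (Nat.succ_pos m) (one_pow (M := ℂ) (m + 1))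
  have h2 := congrArg (Polynomial.eval (-1)) h
  simp only [Polynomial.eval_sub, Polynomial.eval_pow, Polynomial.eval_X, Polynomial.eval_C,
    eval_prod, hm.neg_one_pow, mul_one] at h2
  rw [Finset.prod_range_succ', pow_zero] at h2
  have h3 : ∏ k ∈ Finset.range m, (-1 - ζ ^ (k + 1)) = qfacNeg ζ m := by
    have hm' : Even m := by
      rcases Nat.even_or_odd m with h | h
      · exact h
      · exact absurd hm (by simpa using h.add_one)
    rw [qfacNeg, ← one_mul (∏ j ∈ Finset.range m, (1 + ζ ^ (j + 1))), ← hm'.neg_one_pow (α := ℂ),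
      ← Finset.card_range m, ← Finset.prod_const, Finset.card_range, ← Finset.prod_mul_distrib]
    exact Finset.prod_congr rfl fun j _ => by ring
  rw [h3] at h2
  linear_combination (1 / 2 : ℂ) * h2

lemma cyclotomic_dvd_of_aeval_eq_zero {n : ℕ} (hn : 0 < n) {ζ : ℂ} (hζ : IsPrimitiveRoot ζ n)
    {f : ℚ[X]} (hf : aeval ζ f = 0) : cyclotomic n ℚ ∣ f := by
  rw [cyclotomic_eq_minpoly_rat hζ hn]
  exact minpoly.dvd ℚ ζ hf

lemma cyclotomic_dvd_sub_qCatalan_sq {m : ℕ} (hm : Odd (m + 2)) {c : ℚ[X]}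
    (hc : (1 - Polynomial.X ^ (m + 2)) * c * qfac Polynomial.X (m + 1) ^ 2
      = (1 - Polynomial.X) * qfac Polynomial.X (2 * (m + 1))) :
    cyclotomic (m + 2) ℚ ∣ Polynomial.X ^ 2 * qfacNeg Polynomial.X (m + 1) ^ 4 - c ^ 2 := by
  have hζ := Complex.isPrimitiveRoot_exp (m + 2) (by omega)
  refine cyclotomic_dvd_of_aeval_eq_zero (by omega) hζ ?_
  have hP := map_qfacNeg
    (aeval (Complex.exp (2 * Real.pi * Complex.I / (m + 2 : ℕ))) : ℚ[X] →ₐ[ℚ] ℂ).toRingHom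
    Polynomial.X (m + 1)
  simp only [AlgHom.toRingHom_eq_coe, RingHom.coe_coe, aeval_X,
    qfacNeg_of_isPrimitiveRoot hm hζ] at hP
  simp only [map_sub, map_mul, map_pow, aeval_X, hP, aeval_qCatalan hζ hc]
  ring

lemma isCoprime_one_add_pow {n : ℕ} (hn : Odd n) (x : ℚ[X]) (j : ℕ) :
    IsCoprime (1 + x ^ j) (x ^ n - 1) := by
  obtain ⟨a, ha⟩ : 1 + x ^ j ∣ 1 + (x ^ j) ^ n := by
    simpa using hn.add_dvd_pow_add_pow 1 (x ^ j)
  obtain ⟨b, hb⟩ : x ^ n - 1 ∣ (x ^ n) ^ j - 1 := by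
    simpa using sub_dvd_pow_sub_pow (x ^ n) 1 j
  refine ⟨Polynomial.C (1 / 2) * a, -(Polynomial.C (1 / 2) * b), ?_⟩
  have h2 : (Polynomial.C (1 / 2) : ℚ[X]) * 2 = 1 := by
    rw [show (2 : ℚ[X]) = Polynomial.C 2 from rfl, ← Polynomial.C_mul]; norm_num
  have e : (x ^ j) ^ n = (x ^ n) ^ j := pow_right_comm x j n
  linear_combination Polynomial.C (1 / 2) * (hb - ha) + Polynomial.C (1 / 2) * e + h2

lemma isCoprime_qfacNeg {n : ℕ} (hn : Odd n) (x : ℚ[X]) (m : ℕ) :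
    IsCoprime (qfacNeg x m) (x ^ n - 1) :=
  IsCoprime.prod_left fun j _ => isCoprime_one_add_pow hn x (j + 1)

lemma isCoprime_self_pow_sub_one {n : ℕ} (hn : n ≠ 0) (x : ℚ[X]) : IsCoprime x (x ^ n - 1) := by
  obtain ⟨k, rfl⟩ := Nat.exists_eq_succ_of_ne_zero hn
  exact ⟨x ^ k, -1, by rw [pow_succ]; ring⟩

lemma qintP2_mul (n : ℕ) : qintP2 n * (Polynomial.X ^ 2 - 1) = (Polynomial.X ^ 2) ^ n - 1 := by
  simp only [qintP2, pow_mul, geom_sum_mul]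

lemma cyclo2_dvd_comp {n : ℕ} {f : ℚ[X]} (h : cyclotomic n ℚ ∣ f) :
    cyclo2 n ∣ f.comp (Polynomial.X ^ 2) :=
  map_dvd (compRingHom (Polynomial.X ^ 2 : ℚ[X])) h

lemma cyclo2_dvd_qintP2 {n : ℕ} (hn : 1 < n) : cyclo2 n ∣ qintP2 n := by
  have h : cyclotomic n ℚ ∣ ∑ i ∈ Finset.range n, Polynomial.X ^ i := by
    have hζ := Complex.isPrimitiveRoot_exp n (by omega)
    refine cyclotomic_dvd_of_aeval_eq_zero (by omega) hζ ?_
    simpa using hζ.geom_sum_eq_zero hn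
  have h2 := cyclo2_dvd_comp h
  rw [← Polynomial.coe_compRingHom_apply] at h2
  simpa [qintP2, pow_mul] using h2

lemma isCoprime_denominator {n : ℕ} (hn : Odd n) (m : ℕ) :
    IsCoprime (Polynomial.X ^ 4 * qfacNeg (Polynomial.X ^ 2) m ^ 4) (qintP2 n * cyclo2 n) := by
  have hX : IsCoprime (Polynomial.X ^ 4 : ℚ[X]) ((Polynomial.X ^ 2) ^ n - 1) := by
    have h : IsCoprime ((Polynomial.X ^ 2 : ℚ[X]) ^ 2) ((Polynomial.X ^ 2) ^ n - 1) :=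
      (isCoprime_self_pow_sub_one hn.pos.ne' (Polynomial.X ^ 2)).pow_left
    rwa [← pow_mul] at h
  have hD : IsCoprime (Polynomial.X ^ 4 * qfacNeg (Polynomial.X ^ 2) m ^ 4)
      ((Polynomial.X ^ 2 : ℚ[X]) ^ n - 1) :=
    hX.mul_left (isCoprime_qfacNeg hn _ _).pow_left
  refine IsCoprime.mul_right ?_ ?_
  · exact hD.of_isCoprime_of_dvd_right ⟨_, (qintP2_mul _).symm⟩
  · refine hD.of_isCoprime_of_dvd_right ?_
    simpa using cyclo2_dvd_comp (cyclotomic.dvd_X_pow_sub_one n ℚ)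

end Polynomial

section Field

variable {F : Type*} [Field F]

lemma sum_telescoping {x : F} (hx : x ≠ 0) (h : ∀ m : ℕ, 1 - x ^ (m + 1) ≠ 0) (n : ℕ) :
    (∑ k ∈ Finset.range n, (1 - x ^ (4 * (k : ℤ) - 1)) / (1 - x) *
        (∏ j ∈ Finset.range k, (1 - x⁻¹ ^ 2 * (x ^ 4) ^ j)) ^ 2 /
        (∏ j ∈ Finset.range k, (1 - x ^ 4 * (x ^ 4) ^ j)) ^ 2 * x ^ (4 * k)) *
      ((1 - x ^ 2) ^ 2 * (1 + x)) =
    -(x ^ 3 + x ^ (4 * n)) * (1 - x ^ (4 * n)) ^ 2 *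
      (∏ j ∈ Finset.range n, (1 - x⁻¹ ^ 2 * (x ^ 4) ^ j)) ^ 2 /
        (∏ j ∈ Finset.range n, (1 - x ^ 4 * (x ^ 4) ^ j)) ^ 2 := by
  induction n with
  | zero => simp
  | succ n ih =>
    rw [Finset.sum_range_succ, add_mul, ih, Finset.prod_range_succ, Finset.prod_range_succ]
    have hB : ∏ j ∈ Finset.range n, (1 - x ^ 4 * (x ^ 4) ^ j) ≠ 0 :=
      Finset.prod_ne_zero_iff.2 fun j _ => by
        have := h (4 * j + 3)
        rwa [show x ^ 4 * (x ^ 4) ^ j = x ^ (4 * j + 3 + 1) by ring]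
    generalize ∏ j ∈ Finset.range n, (1 - x ^ 4 * (x ^ 4) ^ j) = B at hB ⊢
    generalize ∏ j ∈ Finset.range n, (1 - x⁻¹ ^ 2 * (x ^ 4) ^ j) = A
    have e : x ^ (4 * (n : ℤ) - 1) = x ^ (4 * n) / x := by
      rw [zpow_sub_one₀ hx, div_eq_mul_inv]
      norm_cast
    have e1 : x ^ (4 * (n + 1)) = x ^ 4 * x ^ (4 * n) := by ring
    have e2 : (x ^ 4) ^ n = x ^ (4 * n) := by ring
    have hy : 1 - x ^ 4 * x ^ (4 * n) ≠ 0 := by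
      have := h (4 * n + 3)
      rwa [show x ^ (4 * n + 3 + 1) = x ^ 4 * x ^ (4 * n) by ring] at this
    have h1 : 1 - x ≠ 0 := by simpa using h 0
    rw [e, e1, e2]
    generalize x ^ (4 * n) = y at hy ⊢
    field_simp
    ring

end Field

section RatFunc

lemma one_sub_q_pow_ne_zero (m : ℕ) : 1 - q ^ (m + 1) ≠ 0 := by
  have h := (map_ne_zero_iff (algebraMap ℚ[X] (RatFunc ℚ))
    (RatFunc.algebraMap_injective ℚ)).2 (one_sub_X_pow_ne_zero m)
  simpa [q] using h

lemma prod_eq_qfacOdd {F : Type*} [Field F] {x : F} (hx : x ≠ 0) (m : ℕ) :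
    ∏ j ∈ Finset.range (m + 1), (1 - x⁻¹ ^ 2 * (x ^ 4) ^ j)
      = (1 - x⁻¹ ^ 2) * qfacOdd (x ^ 2) m := by
  rw [Finset.prod_range_succ', mul_comm, pow_zero, mul_one, qfacOdd]
  congr 1
  refine Finset.prod_congr rfl fun j _ => ?_
  field_simp
  ring

lemma prod_eq_qfac {R : Type*} [CommRing R] (x : R) (m : ℕ) :
    ∏ j ∈ Finset.range m, (1 - x ^ 4 * (x ^ 4) ^ j) = qfac ((x ^ 2) ^ 2) m :=
  Finset.prod_congr rfl fun j _ => by ring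

end RatFunc

theorem supercongruence_q2_full (n : ℕ) (hn : Odd n) (hn1 : 1 < n) :
    ∃ N D : Polynomial ℚ,
      IsCoprime D (qintP2 n * cyclo2 n) ∧
      algebraMap (Polynomial ℚ) (RatFunc ℚ) D *
          ((∑ k ∈ Finset.range n,
              qintZ (4 * k - 1) * qpoch (q⁻¹ ^ 2) (q ^ 4) k ^ 2 / qpoch (q ^ 4) (q ^ 4) k ^ 2 *
                q ^ (4 * k))
            - (-(1 - q + q ^ 2) * qint2 n ^ 2))
        = algebraMap (Polynomial ℚ) (RatFunc ℚ) N ∧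
      qintP2 n ^ 2 * cyclo2 n ∣ N := by
  obtain ⟨m, rfl⟩ : ∃ m, n = m + 2 := ⟨n - 2, by omega⟩
  obtain ⟨c, hc⟩ := exists_qCatalan (m + 1)
  have hq : q ≠ 0 := RatFunc.X_ne_zero
  set P : ℚ[X] := qfacNeg (Polynomial.X ^ 2) (m + 1) with hP
  set I := qintP2 (m + 2) with hI
  set c₂ : ℚ[X] := c.comp (Polynomial.X ^ 2) with hc₂
  refine ⟨I ^ 2 * ((1 - Polynomial.X + Polynomial.X ^ 2) * (Polynomial.X ^ 4 * P ^ 4 - c₂ ^ 2)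
    - ((Polynomial.X ^ 2) ^ (m + 2) + 1) * (Polynomial.X - 1) * I * c₂ ^ 2),
    Polynomial.X ^ 4 * P ^ 4, ?_, ?_, ?_⟩
  · exact isCoprime_denominator hn _
  · have hS := sum_telescoping hq one_sub_q_pow_ne_zero (m + 2)
    rw [prod_eq_qfac, prod_eq_qfacOdd hq, qfac_succ] at hS
    simp only [qintZ, qpoch]
    set S := ∑ k ∈ Finset.range (m + 2), (1 - q ^ (4 * (k : ℤ) - 1)) / (1 - q) *
        (∏ j ∈ Finset.range k, (1 - q⁻¹ ^ 2 * (q ^ 4) ^ j)) ^ 2 /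
        (∏ j ∈ Finset.range k, (1 - q ^ 4 * (q ^ 4) ^ j)) ^ 2 * q ^ (4 * k)
    have hX : algebraMap ℚ[X] (RatFunc ℚ) Polynomial.X = q := RatFunc.algebraMap_X
    have hPq : algebraMap ℚ[X] (RatFunc ℚ) P = qfacNeg (q ^ 2) (m + 1) := by
      rw [hP, map_qfacNeg, map_pow, hX]
    have hIq : algebraMap ℚ[X] (RatFunc ℚ) I = qint2 (m + 2) := by
      simp [hI, qintP2, qint2, hX]
    have hI2 : qint2 (m + 2) * (q ^ 2 - 1) = (q ^ 2) ^ (m + 2) - 1 := by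
      simpa [← hI, hIq, hX] using congrArg (algebraMap ℚ[X] (RatFunc ℚ)) (qintP2_mul (m + 2))
    have hcq := congrArg ((algebraMap ℚ[X] (RatFunc ℚ)).comp (compRingHom (Polynomial.X ^ 2))) hc
    simp only [map_mul, map_sub, map_one, map_pow, map_qfac] at hcq
    simp only [RingHom.comp_apply, coe_compRingHom_apply, X_comp, map_pow, hX, ← hc₂] at hcq
    simp only [map_mul, map_sub, map_add, map_one, map_pow, hX, hPq, hIq]
    set Cq := algebraMap ℚ[X] (RatFunc ℚ) c₂
    rw [qfac_sq] at hS
    rw [qfac_two_mul] at hcq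
    have hfac : ∀ k, qfac (q ^ 2) k ≠ 0 := fun k => Finset.prod_ne_zero_iff.2 fun j _ => by
      have := one_sub_q_pow_ne_zero (2 * j + 1)
      rwa [← pow_mul, show 2 * (j + 1) = 2 * j + 1 + 1 by ring]
    have hneg : qfac (q ^ 2) (m + 1) * qfacNeg (q ^ 2) (m + 1) ≠ 0 := by
      rw [← qfac_sq]
      exact Finset.prod_ne_zero_iff.2 fun j _ => by
        have := one_sub_q_pow_ne_zero (4 * j + 3)
        rwa [show ((q ^ 2) ^ 2) ^ (j + 1) = q ^ (4 * j + 3 + 1) by ring]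
    have h1 : 1 - q ^ 2 ≠ 0 := one_sub_q_pow_ne_zero 1
    have h1' : 1 + q ≠ 0 := fun h => h1 (by linear_combination (1 - q) * h)
    have h4 : 1 - q ^ (4 * (m + 2)) ≠ 0 := one_sub_q_pow_ne_zero (4 * m + 7)
    rw [show ((q ^ 2) ^ 2) ^ (m + 1 + 1) = q ^ (4 * (m + 2)) by ring] at hS
    have hA := hfac (m + 1)
    have hO : qfacOdd (q ^ 2) (m + 1) * qfacNeg (q ^ 2) (m + 1)
        = qint2 (m + 2) * Cq * qfac (q ^ 2) (m + 1) := by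
      apply mul_left_cancel₀ (mul_ne_zero h1 hA)
      linear_combination Cq * qfac (q ^ 2) (m + 1) ^ 2 * hI2 - hcq
    have hQ := right_ne_zero_of_mul hneg
    generalize qfacNeg (q ^ 2) (m + 1) = Q at *
    generalize qfac (q ^ 2) (m + 1) = A at *
    generalize qint2 (m + 2) = J at *
    have hO' : qfacOdd (q ^ 2) (m + 1) = J * Cq * A / Q := by rw [eq_div_iff hQ, hO]
    rw [hO'] at hS
    have hp : q ^ (4 * (m + 2)) = ((q ^ 2) ^ (m + 2)) ^ 2 := by ring
    rw [hp] at hS h4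
    generalize (q ^ 2) ^ (m + 2) = y at *
    have hSE : q ^ 4 * Q ^ 4 * S * (1 + q) = -(q ^ 3 + y ^ 2) * J ^ 2 * Cq ^ 2 := by
      apply mul_right_cancel₀ (pow_ne_zero 2 h1)
      have : S * ((1 - q ^ 2) ^ 2 * (1 + q)) * (q ^ 4 * Q ^ 4)
          = -(q ^ 3 + y ^ 2) * J ^ 2 * Cq ^ 2 * (1 - q ^ 2) ^ 2 := by
        rw [hS]
        field_simp
        ring
      linear_combination this
    apply mul_right_cancel₀ h1'
    linear_combination hSE + J ^ 2 * Cq ^ 2 * (y + 1) * hI2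
  · refine mul_dvd_mul_left _ (dvd_sub (Dvd.dvd.mul_left ?_ _) ?_)
    · have h := cyclo2_dvd_comp (cyclotomic_dvd_sub_qCatalan_sq hn hc)
      rw [← coe_compRingHom_apply] at h
      simp only [map_sub, map_mul, map_pow, map_qfacNeg, coe_compRingHom_apply, X_comp] at h
      convert h using 2
      ring
    · exact ((cyclo2_dvd_qintP2 hn1).mul_left _).mul_right _
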